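/- arXiv:2507.00604 — 4 statements merged into one kernel-verified Lean document; each statement's English description precedes it below -/
import Mathlib

section
/- Let d = m + n and let L be a lattice in ℝ^d (a discrete subgroup of full rank d) which is contained in ℤ^m × ℝ^n. Then the subgroup L₂ = L ∩ ({0}^m × ℝ^n) has rank n; that is, the ℝ-linear span of L₂ has dimension n. -/
open Module Submodule

/-- The vectors of `ℝ^(m + n)` whose first `m` coordinates vanish form a subspace of dimension
`n`. -/
theorem finrank_ker_funLeft_castAdd (m n : ℕ) :
    finrank ℝ (LinearMap.ker (LinearMap.funLeft ℝ ℝ (Fin.castAdd n : Fin m → Fin (m + n)))) =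
      n := by
  have h := LinearMap.finrank_range_add_finrank_ker
    (LinearMap.funLeft ℝ ℝ (Fin.castAdd n : Fin m → Fin (m + n)))
  rw [LinearMap.range_eq_top.2
    (LinearMap.funLeft_surjective_of_injective _ _ _ (Fin.castAdd_injective m n)),
    finrank_top] at h
  simpa using h

/-- The kernel of a homomorphism `ℤ^(m + n) → ℤ^m` has rank at least `n`. -/
theorem le_finrank_ker_int {m n : ℕ} (f : (Fin (m + n) → ℤ) →ₗ[ℤ] (Fin m → ℤ)) :
    n ≤ finrank ℤ (LinearMap.ker f) := by
  have h := Submodule.finrank_quotient_add_finrank (LinearMap.ker f)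
  rw [f.quotKerEquivRange.finrank_eq, finrank_fin_fun] at h
  have h' : finrank ℤ (LinearMap.range f) ≤ m := by
    simpa using Submodule.finrank_le (LinearMap.range f)
  omega

/-- A subgroup of the lattice spanned by a basis of a real vector space has the same rank over `ℤ`
as its real span. -/
theorem finrank_span_real_eq_of_le_span_int {ι E : Type*} [Finite ι] [NormedAddCommGroup E]
    [NormedSpace ℝ E] [FiniteDimensional ℝ E] (b : Basis ι ℝ E) {P : Submodule ℤ E}
    (hP : P ≤ span ℤ (Set.range b)) :
    finrank ℝ (span ℝ (P : Set E)) = finrank ℤ P := by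
  have hd : DiscreteTopology (span ℤ (P : Set E)) := by
    rw [span_eq]
    have : DiscreteTopology (span ℤ (Set.range b)) := inferInstance
    exact DiscreteTopology.of_subset this hP
  have h := Real.finrank_eq_int_finrank_of_discrete hd
  rwa [Set.finrank, Set.finrank, span_eq] at h

/-- Let `d = m + n` and let `L = A·ℤ^d` be a lattice in `ℝ^d` contained in `ℤ^m × ℝ^n`
(i.e. the first `m` coordinates of each point of `L` are integers). Then the subgroup
`L₂ = L ∩ ({0}^m × ℝ^n)` has rank `n`: the `ℝ`-linear span of `L₂` has dimension `n`. -/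
theorem rank_of_lattice_inter_subspace
    (m n : ℕ) (A : Matrix (Fin (m + n)) (Fin (m + n)) ℝ) (hA : A.det ≠ 0)
    (L : Set (Fin (m + n) → ℝ))
    (hL : L = {v | ∃ z : Fin (m + n) → ℤ, v = A.mulVec fun i => (z i : ℝ)})
    (hLsub : ∀ v ∈ L, ∀ i : Fin m, ∃ c : ℤ, v (Fin.castAdd n i) = (c : ℝ)) :
    Module.finrank ℝ
      (Submodule.span ℝ {v | v ∈ L ∧ ∀ i : Fin m, v (Fin.castAdd n i) = 0}) = n := by
  subst hL
  let S : Set (Fin (m + n) → ℝ) :=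
    {v | v ∈ {v | ∃ z : Fin (m + n) → ℤ, v = A.mulVec fun i => (z i : ℝ)} ∧
      ∀ i : Fin m, v (Fin.castAdd n i) = 0}
  change finrank ℝ (span ℝ S) = n
  apply le_antisymm
  · refine (Submodule.finrank_mono (span_le.2 fun v hv => ?_)).trans
      (finrank_ker_funLeft_castAdd m n).le
    exact LinearMap.mem_ker.2 (funext hv.2)
  let g : (Fin (m + n) → ℤ) →ₗ[ℤ] (Fin (m + n) → ℝ) :=
    A.mulVecLin.restrictScalars ℤ ∘ₗ (Algebra.linearMap ℤ ℝ).compLeft (Fin (m + n))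
  have hg_apply (z : Fin (m + n) → ℤ) : g z = A.mulVec fun i => (z i : ℝ) := rfl
  have hA' : IsUnit A := (Matrix.isUnit_iff_isUnit_det A).2 hA.isUnit
  have hg : Function.Injective g := by
    intro x y hxy
    have h := Matrix.mulVec_injective_of_isUnit hA' hxy
    exact funext fun i => Int.cast_injective (congrFun h i)
  choose c hc using fun j => hLsub (g (Pi.single j 1)) ⟨_, rfl⟩
  let f : (Fin (m + n) → ℤ) →ₗ[ℤ] (Fin m → ℤ) := (Matrix.of fun i j => c j i).mulVecLin
  have hf (z : Fin (m + n) → ℤ) (i : Fin m) : ((f z i : ℤ) : ℝ) = g z (Fin.castAdd n i) := by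
    have hcA (j : Fin (m + n)) : (c j i : ℝ) = A (Fin.castAdd n i) j := by
      rw [← hc j i, hg_apply]
      have : (fun k => ((Pi.single j 1 : Fin (m + n) → ℤ) k : ℝ)) = Pi.single j 1 := by
        ext k; simp [Pi.single_apply]
      rw [this, Matrix.mulVec_single_one, Matrix.col_apply]
    simp [f, hg_apply, Matrix.mulVec, dotProduct, hcA]
  have hS : S = ((LinearMap.ker f).map g : Submodule ℤ (Fin (m + n) → ℝ)) := by
    ext v
    constructor
    · rintro ⟨⟨z, rfl⟩, hz⟩
      refine ⟨z, LinearMap.mem_ker.2 (funext fun i => ?_), rfl⟩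
      exact_mod_cast (hf z i).trans (hz i)
    · rintro ⟨z, hz, rfl⟩
      refine ⟨⟨z, rfl⟩, fun i => ?_⟩
      rw [← hf, LinearMap.mem_ker.1 hz, Pi.zero_apply, Int.cast_zero]
  let b : Basis (Fin (m + n)) ℝ (Fin (m + n) → ℝ) :=
    (Pi.basisFun ℝ (Fin (m + n))).map (A.toLinearEquiv' hA'.invertible)
  have hb (j : Fin (m + n)) : b j = A.col j := by
    rw [Basis.map_apply, Pi.basisFun_apply]
    exact A.mulVec_single_one j
  have hle : (LinearMap.ker f).map g ≤ span ℤ (Set.range b) := by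
    rintro _ ⟨z, -, rfl⟩
    have : g z = ∑ j, z j • b j := by
      ext i
      simp [hg_apply, hb, Matrix.mulVec, dotProduct, mul_comm]
    rw [this]
    exact sum_mem fun j _ => smul_mem _ _ (subset_span ⟨j, rfl⟩)
  rw [hS, finrank_span_real_eq_of_le_span_int b hle,
    ← ((LinearMap.ker f).equivMapOfInjective g hg).finrank_eq]
  exact le_finrank_ker_int f
end

section
/- Let G be an abelian group and let G₁ and G₂ be subgroups of G both of the same finite index k. Then there exist elements g₁, …, g_k ∈ G which form simultaneously a complete set of coset representatives of G₁ in G and of G₂ in G; that is, every element of G can be written uniquely as h + g_i with h ∈ G₁ and i ∈ {1,…,k}, and also uniquely as h' + g_j with h' ∈ G₂ and j ∈ {1,…,k}. -/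
/-- A family whose classes enumerate `G ⧸ H` without repetition is a complete set of coset
representatives of `H`. -/
theorem AddSubgroup.existsUnique_add_of_bijective_mk {G ι : Type*} [AddCommGroup G]
    (H : AddSubgroup G) (g : ι → G)
    (hg : Function.Bijective fun i => (QuotientAddGroup.mk (g i) : G ⧸ H)) (x : G) :
    ∃! p : H × ι, x = (p.1 : G) + g p.2 := by
  obtain ⟨i, hi⟩ := hg.2 (QuotientAddGroup.mk x)
  have hx : x - g i ∈ H := by
    simpa [sub_eq_neg_add] using QuotientAddGroup.eq.1 hi
  refine ⟨(⟨x - g i, hx⟩, i), by simp, ?_⟩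
  rintro ⟨⟨h, hh⟩, j⟩ hj
  have hij : j = i := by
    refine hg.1 ((QuotientAddGroup.eq.2 ?_).trans hi.symm)
    simpa [hj] using hh
  subst hij
  simp [hj]

/-- Subgroups of the same finite index in an abelian group admit a bijection between their
cosets under which corresponding cosets intersect. -/
theorem AddSubgroup.exists_quotient_equiv_forall_exists_mk_eq {G : Type*} [AddCommGroup G]
    (H K : AddSubgroup G) [H.FiniteIndex] (h : H.index = K.index) :
    ∃ e : G ⧸ H ≃ G ⧸ K, ∀ c : G ⧸ H, ∃ x : G,
      QuotientAddGroup.mk x = c ∧ QuotientAddGroup.mk x = e c := by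
  have : K.FiniteIndex := ⟨h ▸ FiniteIndex.index_ne_zero⟩
  have : (H ⊔ K).FiniteIndex := finiteIndex_of_le le_sup_left
  have hcard : H.relIndex (H ⊔ K) = K.relIndex (H ⊔ K) := by
    refine Nat.eq_of_mul_eq_mul_right
      (Nat.pos_of_ne_zero (FiniteIndex.index_ne_zero (H := H ⊔ K))) ?_
    rw [relIndex_mul_index le_sup_left, relIndex_mul_index le_sup_right, h]
  let f : (↥(H ⊔ K) ⧸ H.addSubgroupOf (H ⊔ K)) ≃ (↥(H ⊔ K) ⧸ K.addSubgroupOf (H ⊔ K)) :=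
    (Finite.card_eq.1 hcard).some
  let a := quotientEquivProdOfLE (le_sup_left : H ≤ H ⊔ K)
  let b := quotientEquivProdOfLE (le_sup_right : K ≤ H ⊔ K)
  refine ⟨(a.trans ((Equiv.refl _).prodCongr f)).trans b.symm, fun c => ?_⟩
  generalize hd : ((a.trans ((Equiv.refl _).prodCongr f)).trans b.symm) c = d
  have hcd : (a c).1 = (b d).1 := by simp [← hd]
  induction c using QuotientAddGroup.induction_on with | _ y
  induction d using QuotientAddGroup.induction_on with | _ z
  have hyz : -y + z ∈ H ⊔ K := QuotientAddGroup.eq.1 hcd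
  obtain ⟨u, hu, v, hv, huv⟩ := mem_sup.1 hyz
  refine ⟨y + u, QuotientAddGroup.eq.2 (by simpa using hu), QuotientAddGroup.eq.2 ?_⟩
  have : -(y + u) + z = v := by rw [neg_add_rev, add_assoc, ← huv, neg_add_cancel_left]
  rwa [this]

/-- If `G₁` and `G₂` are subgroups of the same finite index `k` in an abelian group `G`,
then there are elements `g 1, …, g k` of `G` which are simultaneously a complete set of
coset representatives of `G₁` and of `G₂` in `G`: every element of `G` is uniquely a sum
`h + g i` with `h ∈ G₁`, and uniquely a sum `h' + g j` with `h' ∈ G₂`. -/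
theorem common_coset_representatives
    {G : Type*} [AddCommGroup G] (G₁ G₂ : AddSubgroup G) (k : ℕ) (hk : 0 < k)
    (h1 : G₁.index = k) (h2 : G₂.index = k) :
    ∃ g : Fin k → G,
      (∀ x : G, ∃! p : G₁ × Fin k, x = (p.1 : G) + g p.2) ∧
      (∀ x : G, ∃! p : G₂ × Fin k, x = (p.1 : G) + g p.2) := by
  have : G₁.FiniteIndex := ⟨by omega⟩
  obtain ⟨e, he⟩ := G₁.exists_quotient_equiv_forall_exists_mk_eq G₂ (h1.trans h2.symm)
  choose r hr₁ hr₂ using he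
  let n : Fin k ≃ G ⧸ G₁ := (Finite.equivFinOfCardEq h1).symm
  refine ⟨r ∘ n, G₁.existsUnique_add_of_bijective_mk _ ?_,
    G₂.existsUnique_add_of_bijective_mk _ ?_⟩
  · simpa only [Function.comp_apply, hr₁] using n.bijective
  · simpa only [Function.comp_apply, hr₂] using! e.bijective.comp n.bijective
end

section
/- Let L and M be lattices in ℝ^d. Let Ω_L be a measurable fundamental domain of L and Ω_M a measurable fundamental domain of M. Suppose Ω_L is partitioned into measurable sets S₁, …, S_N, and there exist ℓ₁, …, ℓ_N ∈ L and m₁, …, m_N ∈ M such that the sets S_i + ℓ_i + m_i are pairwise disjoint and their union equals Ω_M up to a set of Lebesgue measure zero. Then the set E = ⋃_{i=1}^N (S_i + ℓ_i) tiles ℝ^d by translations of L and tiles ℝ^d by translations of M (in the almost-everywhere sense). -/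
open MeasureTheory

/-- The lattice `A·ℤ^d` as an additive subgroup of `ℝ^d`. -/
noncomputable def matrixLattice {d : ℕ} (A : Matrix (Fin d) (Fin d) ℝ) :
    AddSubgroup (Fin d → ℝ) :=
  (A.mulVecLin.toAddMonoidHom.comp ((Int.castAddHom ℝ).compLeft (Fin d))).range

theorem coe_matrixLattice {d : ℕ} (A : Matrix (Fin d) (Fin d) ℝ) :
    (matrixLattice A : Set (Fin d → ℝ)) =
      {v | ∃ z : Fin d → ℤ, v = A.mulVec fun i => (z i : ℝ)} := by
  ext v
  exact ⟨fun ⟨z, hz⟩ => ⟨z, hz.symm⟩, fun ⟨z, hz⟩ => ⟨z, hz.symm⟩⟩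

theorem countable_matrixLattice {d : ℕ} (A : Matrix (Fin d) (Fin d) ℝ) :
    (matrixLattice A : Set (Fin d → ℝ)).Countable :=
  Set.countable_range _

/-- Moving each piece of a partition by an element of `G` preserves the property that exactly
one `G`-translate of the union contains `x`. -/
theorem existsUnique_translate_iUnion_of_mem {V ι : Type*} [AddCommGroup V] (G : AddSubgroup V)
    {P Q : ι → Set V} (hP : Pairwise fun i j => Disjoint (P i) (P j))
    {g : ι → V} (hg : ∀ i, g i ∈ G) (hQ : ∀ i y, y ∈ Q i ↔ y - g i ∈ P i) {x : V}
    (hx : ∃! t, t ∈ G ∧ x - t ∈ ⋃ i, P i) :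
    ∃! t, t ∈ G ∧ x - t ∈ ⋃ i, Q i := by
  obtain ⟨t, ⟨htG, ht⟩, huniq⟩ := hx
  obtain ⟨i, hi⟩ := Set.mem_iUnion.1 ht
  refine ⟨t - g i, ⟨G.sub_mem htG (hg i), Set.mem_iUnion.2 ⟨i, (hQ i _).2 ?_⟩⟩, ?_⟩
  · rwa [show x - (t - g i) - g i = x - t by abel]
  · rintro s ⟨hsG, hs⟩
    obtain ⟨j, hj⟩ := Set.mem_iUnion.1 hs
    have hj' : x - (s + g j) ∈ P j := by
      rw [← sub_sub]
      exact (hQ j _).1 hj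
    have hst : s + g j = t :=
      huniq _ ⟨G.add_mem hsG (hg j), Set.mem_iUnion.2 ⟨j, hj'⟩⟩
    obtain rfl : j = i := by
      by_contra hne
      exact Set.disjoint_left.1 (hP hne) (hst ▸ hj') hi
    exact eq_sub_of_add_eq hst

/-- Almost everywhere equal sets have almost everywhere the same translates by elements of a
countable set. -/
theorem ae_forall_sub_mem_iff {V : Type*} [AddCommGroup V] [MeasurableSpace V]
    [MeasurableAdd V] {μ : Measure V} [μ.IsAddRightInvariant] {T : Set V} (hT : T.Countable)
    {E F : Set V} (hEF : E =ᵐ[μ] F) :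
    ∀ᵐ x ∂μ, ∀ t ∈ T, (x - t ∈ E ↔ x - t ∈ F) := by
  refine (ae_ball_iff hT).2 fun t _ => ?_
  have hpres : MeasurePreserving (fun x => x - t) μ μ := by
    simpa only [sub_eq_add_neg] using measurePreserving_add_right μ (-t)
  exact hpres.quasiMeasurePreserving.ae hEF.mem_iff

/-- Let `L = A·ℤ^d` and `M = B·ℤ^d` be lattices in `ℝ^d`, with measurable fundamental
domains `ΩL`, `ΩM`. If `ΩL` is partitioned into measurable pieces `S 1, …, S N`, and
there are `ℓ i ∈ L`, `m i ∈ M` such that the sets `S i + ℓ i + m i` are pairwise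
disjoint with union equal to `ΩM` up to measure zero, then `E = ⋃ i (S i + ℓ i)` tiles
`ℝ^d` by translations of `L` and by translations of `M` (almost everywhere). -/
theorem equidecomposition_gives_common_tile
    (d N : ℕ) (A B : Matrix (Fin d) (Fin d) ℝ) (hA : A.det ≠ 0) (hB : B.det ≠ 0)
    (L M : Set (Fin d → ℝ))
    (hLdef : L = {v | ∃ z : Fin d → ℤ, v = A.mulVec fun i => (z i : ℝ)})
    (hMdef : M = {v | ∃ z : Fin d → ℤ, v = B.mulVec fun i => (z i : ℝ)})
    (ΩL ΩM : Set (Fin d → ℝ)) (hΩLm : MeasurableSet ΩL) (hΩMm : MeasurableSet ΩM)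
    (hΩL : ∀ᵐ x : Fin d → ℝ ∂volume, ∃! t, t ∈ L ∧ x - t ∈ ΩL)
    (hΩM : ∀ᵐ x : Fin d → ℝ ∂volume, ∃! t, t ∈ M ∧ x - t ∈ ΩM)
    (S : Fin N → Set (Fin d → ℝ)) (hSm : ∀ i, MeasurableSet (S i))
    (hSdisj : Pairwise fun i j => Disjoint (S i) (S j))
    (hScover : (⋃ i, S i) = ΩL)
    (ℓ : Fin N → (Fin d → ℝ)) (hℓ : ∀ i, ℓ i ∈ L)
    (m : Fin N → (Fin d → ℝ)) (hm : ∀ i, m i ∈ M)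
    (hdisj : Pairwise fun i j =>
      Disjoint ((fun x => x + (ℓ i + m i)) '' S i) ((fun x => x + (ℓ j + m j)) '' S j))
    (hunion : (⋃ i, (fun x => x + (ℓ i + m i)) '' S i) =ᵐ[volume] ΩM) :
    (∀ᵐ x : Fin d → ℝ ∂volume,
      ∃! t, t ∈ L ∧ x - t ∈ (⋃ i, (fun x => x + ℓ i) '' S i)) ∧
    (∀ᵐ x : Fin d → ℝ ∂volume,
      ∃! t, t ∈ M ∧ x - t ∈ (⋃ i, (fun x => x + ℓ i) '' S i)) := by
  rw [← coe_matrixLattice] at hLdef hMdef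
  subst hLdef hMdef
  have mem_image (i : Fin N) (v y : Fin d → ℝ) :
      y ∈ (fun x => x + v) '' S i ↔ y - v ∈ S i := by
    simp [sub_eq_add_neg]
  constructor
  · subst hScover
    filter_upwards [hΩL] with x hx
    exact existsUnique_translate_iUnion_of_mem _ hSdisj hℓ (fun i y => mem_image i _ y) hx
  · filter_upwards [hΩM, ae_forall_sub_mem_iff (countable_matrixLattice B) hunion]
      with x hx hiff
    refine existsUnique_translate_iUnion_of_mem _ hdisj (g := fun i => -m i)
      (fun i => neg_mem (hm i)) (fun i y => ?_)
      ((existsUnique_congr fun t => and_congr_right (hiff t)).2 hx)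
    rw [mem_image, mem_image, show y - -m i - (ℓ i + m i) = y - ℓ i by abel]
end

section
/- Let Γ be a lattice in ℝ^d × ℝ^d, let p₁ and p₂ denote the projections of ℝ^d × ℝ^d onto the first and second factor respectively, and assume p₁ restricted to Γ is injective and p₂(Γ) is dense in ℝ^d. Let W and W' be half-open parallelotopes in ℝ^d, each spanned by d linearly independent vectors belonging to p₂(Γ), with equal Lebesgue measure |W| = |W'|. Then the model sets Λ(Γ,W) = { p₁(γ) : γ ∈ Γ, p₂(γ) ∈ W } and Λ(Γ,W') = { p₁(γ) : γ ∈ Γ, p₂(γ) ∈ W' } are bounded distance equivalent: there exist a bijection φ : Λ(Γ,W) → Λ(Γ,W') and a constant C > 0 with ‖φ(λ) − λ‖ < C for all λ ∈ Λ(Γ,W). -/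
open MeasureTheory

/-- One half of `exists_bijective_dist_le_of_sum_eq`, by Hall's marriage theorem. -/
theorem exists_injective_dist_le_of_sum_eq {X ι κ : Type*} [PseudoMetricSpace X]
    [MeasurableSpace X] [OpensMeasurableSpace X] {p : ι → X} {q : κ → X}
    {m : ι → Measure X} {n : κ → Measure X} {c : ENNReal} {ρ σ : ℝ}
    (hc₀ : c ≠ 0) (hc : c ≠ ⊤)
    (hm : ∀ i, m i Set.univ = c) (hn : ∀ k, n k Set.univ = c)
    (hmp : ∀ i, m i (Metric.closedBall (p i) ρ)ᶜ = 0)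
    (hnq : ∀ k, n k (Metric.closedBall (q k) σ)ᶜ = 0)
    (hq : ∀ x r, {k | dist x (q k) ≤ r}.Finite)
    (hsum : Measure.sum m = Measure.sum n) :
    ∃ f : ι → κ, Function.Injective f ∧ ∀ i, dist (p i) (q (f i)) ≤ ρ + σ := by
  classical
  obtain ⟨f, hf, hfd⟩ := (Finset.all_card_le_biUnion_card_iff_exists_injective
    fun i => (hq (p i) (ρ + σ)).toFinset).1 fun s => by
      set N := s.biUnion fun i => (hq (p i) (ρ + σ)).toFinset
      set U : Set X := ⋃ i ∈ s, Metric.closedBall (p i) ρ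
      have hUm : MeasurableSet U :=
        s.measurableSet_biUnion fun i _ => Metric.isClosed_closedBall.measurableSet
      have hmU : ∀ i ∈ s, m i U = c := fun i hi => by
        have h0 : m i Uᶜ = 0 := measure_mono_null
          (Set.compl_subset_compl.2 (Set.subset_biUnion_of_mem (u := fun i =>
            Metric.closedBall (p i) ρ) hi)) (hmp i)
        rw [← hm i, ← measure_add_measure_compl hUm, h0, add_zero]
      have hnU : ∀ k ∉ N, n k U = 0 := fun k hk => by
        refine measure_mono_null (t := (Metric.closedBall (q k) σ)ᶜ) (fun x hx hxk => hk ?_) (hnq k)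
        obtain ⟨i, hi, hxi⟩ := Set.mem_iUnion₂.1 hx
        refine Finset.mem_biUnion.2 ⟨i, hi, (Set.Finite.mem_toFinset _).2 ?_⟩
        exact (dist_triangle_left _ _ x).trans (add_le_add hxi hxk)
      have key : (s.card : ENNReal) * c ≤ N.card * c := calc
        (s.card : ENNReal) * c = ∑ i ∈ s, m i U := by
          rw [Finset.sum_congr rfl hmU, Finset.sum_const, nsmul_eq_mul]
        _ ≤ ∑' i, m i U := ENNReal.sum_le_tsum s
        _ = ∑' k, n k U := by
          rw [← Measure.sum_apply _ hUm, hsum, Measure.sum_apply _ hUm]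
        _ = ∑ k ∈ N, n k U := tsum_eq_sum hnU
        _ ≤ ∑ _k ∈ N, c :=
          Finset.sum_le_sum fun k _ => (measure_mono (Set.subset_univ U)).trans (hn k).le
        _ = N.card * c := by rw [Finset.sum_const, nsmul_eq_mul]
      exact_mod_cast (ENNReal.mul_le_mul_iff_left hc₀ hc).1 key
  exact ⟨f, hf, fun i => by simpa using hfd i⟩

/-- Two families of points are bounded distance equivalent if each of their points carries a
measure of mass `c` concentrated near it, and both families of measures have the same sum. -/
theorem exists_bijective_dist_le_of_sum_eq {X ι κ : Type*} [PseudoMetricSpace X]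
    [MeasurableSpace X] [OpensMeasurableSpace X] {p : ι → X} {q : κ → X}
    {m : ι → Measure X} {n : κ → Measure X} {c : ENNReal} {ρ σ : ℝ}
    (hc₀ : c ≠ 0) (hc : c ≠ ⊤)
    (hm : ∀ i, m i Set.univ = c) (hn : ∀ k, n k Set.univ = c)
    (hmp : ∀ i, m i (Metric.closedBall (p i) ρ)ᶜ = 0)
    (hnq : ∀ k, n k (Metric.closedBall (q k) σ)ᶜ = 0)
    (hp : ∀ x r, {i | dist x (p i) ≤ r}.Finite) (hq : ∀ x r, {k | dist x (q k) ≤ r}.Finite)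
    (hsum : Measure.sum m = Measure.sum n) :
    ∃ φ : ι → κ, Function.Bijective φ ∧ ∀ i, dist (p i) (q (φ i)) ≤ ρ + σ := by
  obtain ⟨f, hf, hfd⟩ := exists_injective_dist_le_of_sum_eq hc₀ hc hm hn hmp hnq hq hsum
  obtain ⟨g, hg, hgd⟩ := exists_injective_dist_le_of_sum_eq hc₀ hc hn hm hnq hmp hp hsum.symm
  exact Function.Embedding.schroeder_bernstein_of_rel hf hg
    (fun i k => dist (p i) (q k) ≤ ρ + σ) hfd
    fun k => by rw [dist_comm, add_comm]; exact hgd k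

/-- A measure is the sum of its values on the pieces of a countable partition. -/
theorem measure_eq_tsum_inter_of_existsUnique {X ι : Type*} [MeasurableSpace X] [Countable ι]
    (μ : Measure X) {s : ι → Set X} (hs : ∀ i, MeasurableSet (s i)) (h : ∀ x, ∃! i, x ∈ s i)
    {t : Set X} (ht : MeasurableSet t) : μ t = ∑' i, μ (t ∩ s i) := by
  rw [← measure_iUnion _ fun i => ht.inter (hs i), ← Set.inter_iUnion,
    Set.iUnion_eq_univ_iff.2 fun x => (h x).exists, Set.inter_univ]
  exact fun i j hij => Set.disjoint_left.2 fun x hi hj => hij ((h x).unique hi.2 hj.2)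

/-- Every vector is a unique lattice translate of a vector of the fundamental domain. -/
theorem existsUnique_sub_mem_fundamentalDomain {V ι : Type*} [NormedAddCommGroup V]
    [NormedSpace ℝ V] [Finite ι] (b : Module.Basis ι ℝ V) (x : V) :
    ∃! c : Submodule.span ℤ (Set.range b), x - c ∈ ZSpan.fundamentalDomain b := by
  obtain ⟨c, hc, hu⟩ := ZSpan.exist_unique_vadd_mem_fundamentalDomain b x
  refine ⟨-c, ?_, fun y hy => ?_⟩
  · simpa [Submodule.vadd_def, sub_eq_add_neg, add_comm] using hc
  · rw [← hu (-y) (by simpa [Submodule.vadd_def, sub_eq_add_neg, add_comm] using hy), neg_neg]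

section CutAndProject

variable {E F ι κ : Type*} [NormedAddCommGroup E] [NormedSpace ℝ E]
  [NormedAddCommGroup F] [NormedSpace ℝ F]

/-- The lattice points over the half-open parallelotope spanned by `b`. -/
abbrev StripPoint (B : Module.Basis ι ℝ (E × F)) (b : Module.Basis κ ℝ F) : Type _ :=
  {γ : E × F // γ ∈ Submodule.span ℤ (Set.range B) ∧ γ.2 ∈ ZSpan.fundamentalDomain b}

/-- The projection of `E × F` onto `E` along the graph of `A : F → E`. -/
def projAlongGraph (A : F →ₗ[ℝ] E) : E × F →ₗ[ℝ] E :=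
  LinearMap.fst ℝ E F - A ∘ₗ LinearMap.snd ℝ E F

theorem projAlongGraph_apply (A : F →ₗ[ℝ] E) (z : E × F) :
    projAlongGraph A z = z.1 - A z.2 := rfl

variable {B : Module.Basis ι ℝ (E × F)} {b : Module.Basis κ ℝ F} {A : F →ₗ[ℝ] E}

theorem graph_mem_of_basis_mem (hA : ∀ k, (A (b k), b k) ∈ Submodule.span ℤ (Set.range B))
    {c : F} (hc : c ∈ Submodule.span ℤ (Set.range b)) :
    (A c, c) ∈ Submodule.span ℤ (Set.range B) := by
  induction hc using Submodule.span_induction with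
  | mem x hx => obtain ⟨k, rfl⟩ := hx; exact hA k
  | zero => rw [map_zero]; exact Submodule.zero_mem _
  | add x y _ _ hx hy => rw [map_add]; exact Submodule.add_mem _ hx hy
  | smul n x _ hx => rw [map_zsmul]; exact Submodule.smul_mem _ n hx

/-- Strip points represent the cosets of the sublattice lying on the graph of `A`. -/
theorem bijective_graph_add_stripPoint [Finite κ]
    (hA : ∀ k, (A (b k), b k) ∈ Submodule.span ℤ (Set.range B)) :
    Function.Bijective
      (fun x : StripPoint B b × Submodule.span ℤ (Set.range b) =>
        (⟨x.1.1 + (A x.2, (x.2 : F)), Submodule.add_mem _ x.1.2.1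
          (graph_mem_of_basis_mem hA x.2.2)⟩ : Submodule.span ℤ (Set.range B))) := by
  refine ⟨fun x y hxy => ?_, fun γ => ?_⟩
  · have h : x.1.1 + (A x.2, (x.2 : F)) = y.1.1 + (A y.2, (y.2 : F)) := congrArg Subtype.val hxy
    have h2 : x.1.1.2 + x.2 = y.1.1.2 + y.2 := congrArg Prod.snd h
    have hc : x.2 = y.2 := (existsUnique_sub_mem_fundamentalDomain b (x.1.1.2 + x.2)).unique
      (by simpa using x.1.2.2) (by simpa [h2] using y.1.2.2)
    rw [hc] at h
    exact Prod.ext (Subtype.ext (add_right_cancel h)) hc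
  · obtain ⟨c, hc, -⟩ := existsUnique_sub_mem_fundamentalDomain b γ.1.2
    exact ⟨(⟨γ.1 - (A c, (c : F)), Submodule.sub_mem _ γ.2 (graph_mem_of_basis_mem hA c.2), hc⟩, c),
      Subtype.ext (sub_add_cancel _ _)⟩

/-- The points of a tile attached to a strip point project near that strip point. -/
theorem exists_norm_projAlongGraph_sub_le [FiniteDimensional ℝ E] [FiniteDimensional ℝ F]
    [Finite ι] [Finite κ] (B : Module.Basis ι ℝ (E × F)) (b : Module.Basis κ ℝ F)
    (A : F →ₗ[ℝ] E) :
    ∃ ρ : ℝ, ∀ (γ : StripPoint B b) (z : E × F), z - γ.1 ∈ ZSpan.fundamentalDomain B →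
      ‖projAlongGraph A z - γ.1.1‖ ≤ ρ := by
  obtain ⟨r, hr⟩ := (ZSpan.fundamentalDomain_isBounded B).exists_norm_le
  obtain ⟨s, hs⟩ := (ZSpan.fundamentalDomain_isBounded b).exists_norm_le
  set L := LinearMap.toContinuousLinearMap (projAlongGraph A)
  set A' := LinearMap.toContinuousLinearMap A
  refine ⟨‖L‖ * r + ‖A'‖ * s, fun γ z hz => ?_⟩
  have h : projAlongGraph A z - γ.1.1 = L (z - γ.1) - A' γ.1.2 := by
    simp only [L, A', projAlongGraph_apply, LinearMap.coe_toContinuousLinearMap', map_sub]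
    abel
  rw [h]
  exact (norm_sub_le _ _).trans (add_le_add (L.le_opNorm_of_le (hr _ hz))
    (A'.le_opNorm_of_le (hs _ γ.2.2)))

theorem finite_setOf_dist_stripPoint_le [FiniteDimensional ℝ E] [FiniteDimensional ℝ F]
    [Finite ι] [Finite κ] (B : Module.Basis ι ℝ (E × F)) (b : Module.Basis κ ℝ F)
    (x : E) (r : ℝ) : {γ : StripPoint B b | dist x γ.1.1 ≤ r}.Finite := by
  have hbd := (Metric.isBounded_closedBall (x := x) (r := r)).prod
    (ZSpan.fundamentalDomain_isBounded b)
  refine ((ZSpan.setFinite_inter B hbd).preimage Subtype.val_injective.injOn).subset ?_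
  intro γ hγ
  exact ⟨⟨by rw [Metric.mem_closedBall, dist_comm]; exact hγ, γ.2.2⟩, γ.2.1⟩

theorem measurable_projAlongGraph [FiniteDimensional ℝ E] [FiniteDimensional ℝ F]
    [MeasurableSpace E] [BorelSpace E] [MeasurableSpace F] [BorelSpace F] (A : F →ₗ[ℝ] E) :
    Measurable (projAlongGraph A) :=
  (LinearMap.continuous_of_finiteDimensional _).measurable

variable [FiniteDimensional ℝ E] [MeasureSpace E] [BorelSpace E]
  [FiniteDimensional ℝ F] [MeasureSpace F] [BorelSpace F]

/-- The image on `E` of the volume of the fundamental domain translated to a strip point. -/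
noncomputable def tileMeasure (A : F →ₗ[ℝ] E) (γ : StripPoint B b) : Measure E :=
  (volume.restrict ((fun z => z - γ.1) ⁻¹' ZSpan.fundamentalDomain B)).map (projAlongGraph A)

theorem tileMeasure_apply (γ : StripPoint B b) {U : Set E} (hU : MeasurableSet U) :
    tileMeasure A γ U = volume
      (projAlongGraph A ⁻¹' U ∩ (fun z => z - γ.1) ⁻¹' ZSpan.fundamentalDomain B) := by
  have hL := measurable_projAlongGraph A
  rw [tileMeasure, Measure.map_apply hL hU, Measure.restrict_apply (hL hU)]

theorem tileMeasure_compl_closedBall {ρ : ℝ} (γ : StripPoint B b)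
    (hρ : ∀ z : E × F, z - γ.1 ∈ ZSpan.fundamentalDomain B →
      ‖projAlongGraph A z - γ.1.1‖ ≤ ρ) :
    tileMeasure A γ (Metric.closedBall γ.1.1 ρ)ᶜ = 0 := by
  rw [tileMeasure_apply γ Metric.isClosed_closedBall.measurableSet.compl]
  refine measure_mono_null (t := ∅) (fun z hz => hz.1 ?_) measure_empty
  rw [Metric.mem_closedBall, dist_eq_norm]
  exact hρ z hz.2

variable [(volume : Measure E).IsAddHaarMeasure] [(volume : Measure F).IsAddHaarMeasure]

instance isAddHaarMeasure_volume_prod : (volume : Measure (E × F)).IsAddHaarMeasure :=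
  inferInstanceAs ((volume : Measure E).prod (volume : Measure F)).IsAddHaarMeasure

theorem tileMeasure_univ (γ : StripPoint B b) :
    tileMeasure A γ Set.univ = volume (ZSpan.fundamentalDomain B) := by
  rw [tileMeasure_apply γ MeasurableSet.univ, Set.preimage_univ, Set.univ_inter]
  simp_rw [sub_eq_add_neg]
  exact measure_preimage_add_right _ _ _

theorem volume_strip_inter_preimage [Finite κ] (A : F →ₗ[ℝ] E) {U : Set E}
    (hU : MeasurableSet U) :
    volume (projAlongGraph A ⁻¹' U ∩ Prod.snd ⁻¹' ZSpan.fundamentalDomain b) =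
      volume (ZSpan.fundamentalDomain b) * volume U := by
  have hW := ZSpan.fundamentalDomain_measurableSet b
  rw [Measure.volume_eq_prod, Measure.prod_apply_symm
    ((measurable_projAlongGraph A hU).inter (measurable_snd hW))]
  have h : ∀ y : F, volume ((fun x : E => (x, y)) ⁻¹'
      (projAlongGraph A ⁻¹' U ∩ Prod.snd ⁻¹' ZSpan.fundamentalDomain b)) =
      (ZSpan.fundamentalDomain b).indicator (fun _ => volume U) y := fun y => by
    by_cases hy : y ∈ ZSpan.fundamentalDomain b
    · rw [Set.indicator_of_mem hy, ← measure_preimage_add_right volume (-A y) U]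
      congr 1
      ext x
      simp [hy, projAlongGraph_apply, sub_eq_add_neg]
    · rw [Set.indicator_of_notMem hy]
      refine measure_mono_null (t := ∅) (fun x hx => hy hx.2) measure_empty
  simp_rw [h]
  rw [lintegral_indicator_const hW, mul_comm]

/-- The tiles of the strip points cover `E`, in total, uniformly. -/
theorem sum_tileMeasure [Finite ι] [Finite κ]
    (hA : ∀ k, (A (b k), b k) ∈ Submodule.span ℤ (Set.range B)) :
    Measure.sum (tileMeasure (B := B) (b := b) A) =
      volume (ZSpan.fundamentalDomain b) • volume := by
  ext U hU
  have hL := measurable_projAlongGraph A hU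
  have hD := ZSpan.fundamentalDomain_measurableSet B
  have hW := ZSpan.fundamentalDomain_measurableSet b
  set S : Set (E × F) := Prod.snd ⁻¹' ZSpan.fundamentalDomain b with hS
  set V : Set (E × F) := projAlongGraph A ⁻¹' U with hV
  let D (γ : E × F) : Set (E × F) := (fun z => z - γ) ⁻¹' ZSpan.fundamentalDomain B
  have hDm (γ : E × F) : MeasurableSet (D γ) := measurable_sub_const γ hD
  have hSm : MeasurableSet S := measurable_snd hW
  have key (γ : StripPoint B b) (c : Submodule.span ℤ (Set.range b)) :
      volume (V ∩ D γ.1 ∩ {z | z.2 - -(c : F) ∈ ZSpan.fundamentalDomain b}) =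
        volume (V ∩ S ∩ D (γ.1 + (A c, (c : F)))) := by
    rw [← measure_preimage_add_right volume (A c, (c : F)) (V ∩ S ∩ D _)]
    congr 1
    ext z
    have h1 : projAlongGraph A (z + (A c, (c : F))) = projAlongGraph A z := by
      simp [projAlongGraph_apply]
    have h2 : z + (A c, (c : F)) - (γ.1 + (A c, (c : F))) = z - γ.1 :=
      add_sub_add_right_eq_sub _ _ _
    simp only [Set.mem_inter_iff, Set.mem_preimage, Set.mem_ofPred_eq, hV, hS, D, h1, h2,
      sub_neg_eq_add, Prod.snd_add]
    tauto
  have hpart (y : F) : ∃! c : Submodule.span ℤ (Set.range b),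
      y - -(c : F) ∈ ZSpan.fundamentalDomain b := by
    obtain ⟨c, hc, hu⟩ := existsUnique_sub_mem_fundamentalDomain b y
    refine ⟨-c, by simpa using hc, fun c' hc' => ?_⟩
    rw [← hu (-c') (by simpa using hc'), neg_neg]
  calc Measure.sum (tileMeasure (B := B) (b := b) A) U
      = ∑' γ : StripPoint B b, volume (V ∩ D γ.1) := by
        rw [Measure.sum_apply _ hU]
        exact tsum_congr fun γ => tileMeasure_apply γ hU
    _ = ∑' (γ : StripPoint B b) (c : Submodule.span ℤ (Set.range b)),
          volume (V ∩ S ∩ D (γ.1 + (A c, (c : F)))) := by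
        refine tsum_congr fun γ => ?_
        rw [measure_eq_tsum_inter_of_existsUnique volume
          (s := fun c : Submodule.span ℤ (Set.range b) =>
            {z : E × F | z.2 - -(c : F) ∈ ZSpan.fundamentalDomain b})
          (fun c => (measurable_snd.sub_const _) hW) (fun z => hpart z.2) (hL.inter (hDm _))]
        exact tsum_congr (key γ)
    _ = ∑' γ : Submodule.span ℤ (Set.range B), volume (V ∩ S ∩ D γ) := by
        rw [← ENNReal.tsum_prod]
        exact (Equiv.ofBijective _ (bijective_graph_add_stripPoint hA)).tsum_eq
          fun γ => volume (V ∩ S ∩ D γ)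
    _ = volume (V ∩ S) := (measure_eq_tsum_inter_of_existsUnique volume (fun _ => hDm _)
        (existsUnique_sub_mem_fundamentalDomain B) (hL.inter hSm)).symm
    _ = _ := by
        rw [volume_strip_inter_preimage A hU, Measure.smul_apply, smul_eq_mul]

/-- The strip points over two parallelotopes of equal volume, spanned by projections of lattice
vectors, are in bijection with bounded displacement. -/
theorem exists_bijective_stripPoint_dist_le [Finite ι] [Finite κ]
    (B : Module.Basis ι ℝ (E × F)) (b b' : Module.Basis κ ℝ F)
    (hb : ∀ k, b k ∈ Prod.snd '' (Submodule.span ℤ (Set.range B) : Set (E × F)))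
    (hb' : ∀ k, b' k ∈ Prod.snd '' (Submodule.span ℤ (Set.range B) : Set (E × F)))
    (hvol : volume (ZSpan.fundamentalDomain b) = volume (ZSpan.fundamentalDomain b')) :
    ∃ φ : StripPoint B b → StripPoint B b', Function.Bijective φ ∧
      ∃ C : ℝ, ∀ γ, dist γ.1.1 (φ γ).1.1 ≤ C := by
  have lift {b : Module.Basis κ ℝ F}
      (hb : ∀ k, b k ∈ Prod.snd '' (Submodule.span ℤ (Set.range B) : Set (E × F))) :
      ∃ A : F →ₗ[ℝ] E, ∀ k, (A (b k), b k) ∈ Submodule.span ℤ (Set.range B) := by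
    choose g hg hgb using hb
    refine ⟨b.constr ℝ fun k => (g k).1, fun k => ?_⟩
    rw [b.constr_basis, ← hgb k]
    exact hg k
  obtain ⟨A, hA⟩ := lift hb
  obtain ⟨A', hA'⟩ := lift hb'
  obtain ⟨ρ, hρ⟩ := exists_norm_projAlongGraph_sub_le B b A
  obtain ⟨σ, hσ⟩ := exists_norm_projAlongGraph_sub_le B b' A'
  obtain ⟨φ, hφ, hd⟩ := exists_bijective_dist_le_of_sum_eq
    (p := fun γ : StripPoint B b => γ.1.1) (q := fun γ : StripPoint B b' => γ.1.1)
    (ZSpan.measure_fundamentalDomain_ne_zero B)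
    (ZSpan.fundamentalDomain_isBounded B).measure_lt_top.ne
    (tileMeasure_univ (A := A)) (tileMeasure_univ (A := A'))
    (fun γ => tileMeasure_compl_closedBall γ (hρ γ))
    (fun γ => tileMeasure_compl_closedBall γ (hσ γ))
    (finite_setOf_dist_stripPoint_le B b) (finite_setOf_dist_stripPoint_le B b')
    (by rw [sum_tileMeasure hA, sum_tileMeasure hA', hvol])
  exact ⟨φ, hφ, _, hd⟩

end CutAndProject

/-- The half-open parallelotope of a basis, in coordinates. -/
theorem fundamentalDomain_eq_setOf_sum {V κ : Type*} [NormedAddCommGroup V] [NormedSpace ℝ V]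
    [Fintype κ] (b : Module.Basis κ ℝ V) :
    ZSpan.fundamentalDomain b =
      {x | ∃ t : κ → ℝ, (∀ k, 0 ≤ t k ∧ t k < 1) ∧ x = ∑ k, t k • b k} := by
  ext x
  rw [ZSpan.mem_fundamentalDomain]
  refine ⟨fun h => ⟨b.repr x, h, (b.sum_repr x).symm⟩, ?_⟩
  rintro ⟨t, ht, rfl⟩ k
  rw [b.repr_sum_self]
  exact ht k

/-- Let `Γ` be a lattice in `ℝ^d × ℝ^d` (the ℤ-span of `2d` linearly independent
vectors), with `p₁|_Γ` injective and `p₂(Γ)` dense. If `W` and `W'` are half-open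
parallelotopes spanned by `d` linearly independent vectors of `p₂(Γ)`, of equal Lebesgue
measure, then the model sets `Λ(Γ,W)` and `Λ(Γ,W')` are bounded distance equivalent:
there is a bijection `φ : Λ(Γ,W) → Λ(Γ,W')` and a constant `C > 0` with
`‖φ(λ) − λ‖ < C` for all `λ`. -/
theorem model_sets_with_parallelotope_windows_bounded_distance
    (d : ℕ) (Bas : Fin (2 * d) → (Fin d → ℝ) × (Fin d → ℝ))
    (hBas : LinearIndependent ℝ Bas)
    (Γ : Set ((Fin d → ℝ) × (Fin d → ℝ)))
    (hΓ : Γ = {v | ∃ z : Fin (2 * d) → ℤ, v = ∑ j, z j • Bas j})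
    (hinj : Set.InjOn Prod.fst Γ)
    (hdense : Dense (Prod.snd '' Γ))
    (v v' : Fin d → (Fin d → ℝ))
    (hv : LinearIndependent ℝ v) (hv' : LinearIndependent ℝ v')
    (hvΓ : ∀ k, v k ∈ Prod.snd '' Γ) (hv'Γ : ∀ k, v' k ∈ Prod.snd '' Γ)
    (W W' : Set (Fin d → ℝ))
    (hW : W = {x | ∃ t : Fin d → ℝ, (∀ k, 0 ≤ t k ∧ t k < 1) ∧ x = ∑ k, t k • v k})
    (hW' : W' = {x | ∃ t : Fin d → ℝ, (∀ k, 0 ≤ t k ∧ t k < 1) ∧ x = ∑ k, t k • v' k})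
    (hvol : volume W = volume W')
    (Λ Λ' : Set (Fin d → ℝ))
    (hΛ : Λ = {y | ∃ γ ∈ Γ, Prod.fst γ = y ∧ Prod.snd γ ∈ W})
    (hΛ' : Λ' = {y | ∃ γ ∈ Γ, Prod.fst γ = y ∧ Prod.snd γ ∈ W'}) :
    ∃ φ : Λ → Λ', Function.Bijective φ ∧
      ∃ C : ℝ, 0 < C ∧ ∀ lam : Λ, ‖(φ lam : Fin d → ℝ) - (lam : Fin d → ℝ)‖ < C := by
  let B : Module.Basis (Fin (2 * d)) ℝ ((Fin d → ℝ) × (Fin d → ℝ)) :=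
    .mk hBas (hBas.span_eq_top_of_card_eq_finrank' (by simp [two_mul])).ge
  let b : Module.Basis (Fin d) ℝ (Fin d → ℝ) :=
    .mk hv (hv.span_eq_top_of_card_eq_finrank' (by simp)).ge
  let b' : Module.Basis (Fin d) ℝ (Fin d → ℝ) :=
    .mk hv' (hv'.span_eq_top_of_card_eq_finrank' (by simp)).ge
  have hBc : ⇑B = Bas := Module.Basis.coe_mk _ _
  have hbc : ⇑b = v := Module.Basis.coe_mk _ _
  have hbc' : ⇑b' = v' := Module.Basis.coe_mk _ _
  have hΓB : Γ = Submodule.span ℤ (Set.range B) := by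
    ext x
    rw [hΓ, hBc, SetLike.mem_coe, Submodule.mem_span_range_iff_exists_fun]
    exact exists_congr fun z => eq_comm
  have hWb : W = ZSpan.fundamentalDomain b := by rw [fundamentalDomain_eq_setOf_sum, hbc, hW]
  have hWb' : W' = ZSpan.fundamentalDomain b' := by
    rw [fundamentalDomain_eq_setOf_sum, hbc', hW']
  clear_value B b b'
  subst hΓB hWb hWb' hbc hbc' hΛ hΛ'
  obtain ⟨φ, hφ, C, hC⟩ := exists_bijective_stripPoint_dist_le B b b' hvΓ hv'Γ hvol
  let f (c : Module.Basis (Fin d) ℝ (Fin d → ℝ)) (γ : StripPoint B c) :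
      {y | ∃ γ ∈ (Submodule.span ℤ (Set.range B) : Set ((Fin d → ℝ) × (Fin d → ℝ))),
        Prod.fst γ = y ∧ Prod.snd γ ∈ ZSpan.fundamentalDomain c} :=
    ⟨γ.1.1, γ.1, γ.2.1, rfl, γ.2.2⟩
  have hf (c) : Function.Bijective (f c) := by
    refine ⟨fun γ γ' h => Subtype.ext (hinj γ.2.1 γ'.2.1 (congrArg Subtype.val h)), ?_⟩
    rintro ⟨_, γ, hγ, rfl, hγW⟩
    exact ⟨⟨γ, hγ, hγW⟩, rfl⟩
  let e := Equiv.ofBijective _ (hf b)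
  refine ⟨f b' ∘ φ ∘ e.symm, (hf b').comp (hφ.comp e.symm.bijective), |C| + 1, by positivity,
    e.surjective.forall.2 fun γ => ?_⟩
  rw [Function.comp_apply, Function.comp_apply, e.symm_apply_apply, ← dist_eq_norm, dist_comm]
  exact (hC γ).trans_lt ((le_abs_self C).trans_lt (lt_add_one _))
end
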